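/- arXiv:2407.11757 — 2 statements merged into one kernel-verified Lean document; each statement's English description precedes it below -/
import Mathlib

section
/- Any left Leibniz algebra L containing an abelian ideal B of codimension two is solvable; in fact L^(3) = 0 (the third term of the derived series vanishes). -/
/-- The span of all products `[a,b]` with `a ∈ A`, `b ∈ B`. -/
def brSpan {F L : Type*} [Field F] [AddCommGroup L] [Module F L]
    (br : L →ₗ[F] L →ₗ[F] L) (A B : Submodule F L) : Submodule F L :=
  Submodule.span F {z | ∃ a ∈ A, ∃ b ∈ B, z = br a b}

/-- The derived series `L⁽⁰⁾ = L`, `L⁽ᵏ⁺¹⁾ = [L⁽ᵏ⁾, L⁽ᵏ⁾]`. -/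
def leibDerived {F L : Type*} [Field F] [AddCommGroup L] [Module F L]
    (br : L →ₗ[F] L →ₗ[F] L) : ℕ → Submodule F L
  | 0 => ⊤
  | k + 1 => brSpan br (leibDerived br k) (leibDerived br k)

theorem derived_three_aux {F L : Type*} [Field F] [AddCommGroup L]
    [Module F L] (br : L →ₗ[F] L →ₗ[F] L)
    (B : Submodule F L)
    (hab : ∀ a ∈ B, ∀ b ∈ B, br a b = 0)
    (hideal : ∀ b ∈ B, ∀ x : L, br x b ∈ B ∧ br b x ∈ B)
    (x y w : L) (hsp : ∀ z : L, ∃ a b : F, ∃ c ∈ B, z = a • x + b • y + c)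
    (W : Submodule F L) (hW : W = F ∙ w ⊔ B)
    (hxx : br x x ∈ W) (hxy : br x y ∈ W) (hyx : br y x ∈ W) (hyy : br y y ∈ W)
    (hw : br w w ∈ B) : leibDerived br 3 = ⊥ := by
  have hBW : B ≤ W := hW ▸ le_sup_right
  have h1 : leibDerived br 1 ≤ W := by
    refine Submodule.span_le.2 ?_
    rintro _ ⟨u, -, v, -, rfl⟩
    obtain ⟨a, b, c, hc, rfl⟩ := hsp u
    obtain ⟨a', b', c', hc', rfl⟩ := hsp v
    have e : br (a • x + b • y + c) (a' • x + b' • y + c') =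
        (a * a') • br x x + (a * b') • br x y + (b * a') • br y x + (b * b') • br y y
        + br c (a' • x + b' • y + c') + br (a • x + b • y) c' := by
      simp only [map_add, map_smul, LinearMap.add_apply, LinearMap.smul_apply]
      module
    rw [e]
    exact W.add_mem (W.add_mem (W.add_mem (W.add_mem (W.add_mem (W.smul_mem _ hxx)
      (W.smul_mem _ hxy)) (W.smul_mem _ hyx)) (W.smul_mem _ hyy))
      (hBW (hideal c hc _).2)) (hBW (hideal c' hc' _).1)
  have h2 : leibDerived br 2 ≤ B := by
    refine Submodule.span_le.2 ?_
    rintro _ ⟨u, hu, v, hv, rfl⟩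
    have hu := h1 hu
    have hv := h1 hv
    rw [hW] at hu hv
    obtain ⟨p, hp, c, hc, rfl⟩ := Submodule.mem_sup.1 hu
    obtain ⟨q, hq, d, hd, rfl⟩ := Submodule.mem_sup.1 hv
    obtain ⟨a, rfl⟩ := Submodule.mem_span_singleton.1 hp
    obtain ⟨b, rfl⟩ := Submodule.mem_span_singleton.1 hq
    have e : br (a • w + c) (b • w + d) =
        (a * b) • br w w + br c (b • w + d) + br (a • w) d := by
      simp only [map_add, map_smul, LinearMap.add_apply, LinearMap.smul_apply]
      module
    rw [e]
    exact B.add_mem (B.add_mem (B.smul_mem _ hw) (hideal c hc _).2) (hideal d hd _).1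
  refine Submodule.span_eq_bot.2 ?_
  rintro _ ⟨u, hu, v, hv, rfl⟩
  exact hab _ (h2 hu) _ (h2 hv)

theorem spanning_of_basis {F L : Type*} [Field F] [AddCommGroup L]
    [Module F L] (B : Submodule F L) (x y : L)
    (h : ⊤ ≤ Submodule.span F (Set.range ![B.mkQ x, B.mkQ y])) (z : L) :
    ∃ a b : F, ∃ c ∈ B, z = a • x + b • y + c := by
  have hz : B.mkQ z ∈ Submodule.span F (Set.range ![B.mkQ x, B.mkQ y]) := h trivial
  rw [Matrix.range_cons, Matrix.range_cons, Matrix.range_empty, Set.union_empty,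
    Set.singleton_union, Submodule.mem_span_pair] at hz
  obtain ⟨a, b, hz⟩ := hz
  refine ⟨a, b, z - (a • x + b • y), ?_, by abel⟩
  rw [← Submodule.ker_mkQ B, LinearMap.mem_ker, map_sub, map_add, map_smul, map_smul, hz, sub_self]

/-- A left Leibniz algebra with an abelian ideal of codimension two is
solvable; in fact `L⁽³⁾ = 0`. -/
theorem solvable_of_abelian_ideal_codim_two {F L : Type*} [Field F] [AddCommGroup L]
    [Module F L] (br : L →ₗ[F] L →ₗ[F] L)
    (leib : ∀ x y z : L, br x (br y z) = br (br x y) z + br y (br x z))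
    (B : Submodule F L)
    (hab : ∀ a ∈ B, ∀ b ∈ B, br a b = 0)
    (hideal : ∀ b ∈ B, ∀ x : L, br x b ∈ B ∧ br b x ∈ B)
    (hcodim : Module.finrank F (L ⧸ B) = 2) :
    leibDerived br 3 = ⊥ := by
  have hmw : ∀ w : L, w ∈ F ∙ w ⊔ B := fun w =>
    Submodule.mem_sup_left (Submodule.mem_span_singleton_self w)
  have : Module.Finite F (L ⧸ B) := Module.finite_of_finrank_pos (by omega)
  by_cases hsq : ∀ x, br x x ∈ B
  · let bs := Module.finBasisOfFinrankEq F (L ⧸ B) hcodim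
    obtain ⟨x, hx⟩ := B.mkQ_surjective (bs 0)
    obtain ⟨y, hy⟩ := B.mkQ_surjective (bs 1)
    have hr : ![B.mkQ x, B.mkQ y] = bs := by
      ext i; fin_cases i <;> simp [← hx, ← hy]
    have hsp := spanning_of_basis B x y (by rw [hr, bs.span_eq])
    refine derived_three_aux br B hab hideal x y (br x y) hsp _ rfl
      (Submodule.mem_sup_right (hsq x)) (hmw _) ?_ (Submodule.mem_sup_right (hsq y)) (hsq _)
    have e : br y x = (br (x + y) (x + y) - br x x - br y y) - br x y := by
      simp only [map_add, LinearMap.add_apply]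
      abel
    rw [e]
    exact Submodule.sub_mem _ (Submodule.mem_sup_right
      (B.sub_mem (B.sub_mem (hsq _) (hsq _)) (hsq _))) (hmw _)
  · push Not at hsq
    obtain ⟨x, hx⟩ := hsq
    have hs : ∀ z, br (br x x) z = 0 := fun z => by simpa using leib x x z
    have hzero : ∀ a : F, a • br x x ∈ B → a = 0 := fun a ha => by
      by_contra h
      exact hx ((B.smul_mem_iff h).1 ha)
    have hli : LinearIndependent F ![B.mkQ x, B.mkQ (br x x)] := by
      rw [LinearIndependent.pair_iff]
      intro a b hab0
      have hm : a • x + b • br x x ∈ B := by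
        rw [← Submodule.ker_mkQ B, LinearMap.mem_ker, map_add, map_smul, map_smul, hab0]
      have h1 := (hideal _ hm x).2
      have ha : a = 0 := hzero a (by simpa [hs] using h1)
      subst ha
      exact ⟨rfl, hzero b (by simpa using hm)⟩
    have hsp := spanning_of_basis B x (br x x)
      (hli.span_eq_top_of_card_eq_finrank' (by simp [hcodim])).ge
    refine derived_three_aux br B hab hideal x (br x x) (br x x) hsp _ rfl
      (hmw _) ?_ (by simp [hs]) (by simp [hs]) (by simp [hs])
    obtain ⟨a, b, c, hc, e⟩ := hsp (br x (br x x))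
    have h0 : br (br x (br x x)) x = 0 := by
      have := leib x (br x x) x
      simpa [hs] using this.symm
    have ha : a = 0 := by
      apply hzero
      rw [e] at h0
      simp only [map_add, map_smul, LinearMap.add_apply, LinearMap.smul_apply, hs, smul_zero,
        add_zero] at h0
      rw [eq_neg_of_add_eq_zero_left h0]
      exact B.neg_mem (hideal c hc x).2
    rw [e, ha, zero_smul, zero_add]
    exact Submodule.add_mem _ (Submodule.smul_mem _ _ (hmw _)) (Submodule.mem_sup_right hc)
end

section
/- (Schur's bound, used in the paper) Any abelian Lie subalgebra of gl_m(F) (m×m matrices under commutator) has dimension at most ⌊m²/4⌋ + 1. -/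
open Module

/-- A commuting family preserving a nonzero subspace has a common eigenvector in it. -/
lemma exists_common_eigenvector {K V : Type*} [Field K] [IsAlgClosed K] [AddCommGroup V]
    [Module K V] [FiniteDimensional K V] (S : Set (End K V))
    (hS : ∀ f ∈ S, ∀ g ∈ S, f * g = g * f) (U : Submodule K V) (hU : U ≠ ⊥)
    (hinv : ∀ f ∈ S, ∀ x ∈ U, f x ∈ U) :
    ∃ v ∈ U, v ≠ 0 ∧ ∀ f ∈ S, ∃ c : K, f v = c • v := by
  obtain ⟨W, ⟨hW0, hWU, hWinv⟩, hmin⟩ := WellFounded.has_min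
    (wellFounded_lt (α := Submodule K V))
    {W | W ≠ ⊥ ∧ W ≤ U ∧ ∀ f ∈ S, ∀ x ∈ W, f x ∈ W} ⟨U, hU, le_rfl, hinv⟩
  obtain ⟨v, hvW, hv0⟩ := (Submodule.ne_bot_iff W).1 hW0
  refine ⟨v, hWU hvW, hv0, fun f hf => ?_⟩
  have : Nontrivial W := (Submodule.nontrivial_iff_ne_bot).2 hW0
  obtain ⟨c, hc⟩ := Module.End.exists_eigenvalue (LinearMap.restrict f (hWinv f hf))
  obtain ⟨w, hw⟩ := hc.exists_hasEigenvector
  have hw1 : f w = c • (w : V) := by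
    have := congrArg Subtype.val hw.apply_eq_smul
    simpa using this
  have hw0 : (w : V) ≠ 0 := by simpa using hw.2
  refine ⟨c, ?_⟩
  by_contra hne
  refine hmin (W ⊓ LinearMap.ker (f - c • (1 : End K V))) ⟨?_, inf_le_left.trans hWU, ?_⟩
    (lt_of_le_of_ne inf_le_left ?_)
  · rw [Submodule.ne_bot_iff]
    exact ⟨w, ⟨w.2, by simp [hw1]⟩, hw0⟩
  · rintro g hg x ⟨hx, hx'⟩
    refine ⟨hWinv g hg x hx, ?_⟩
    have h1 : f x = c • x := by simpa [sub_eq_zero] using hx'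
    have h2 : f (g x) = g (f x) := LinearMap.congr_fun (hS f hf g hg) x
    simp [h2, h1]
  · intro h
    have : v ∈ W ⊓ LinearMap.ker (f - c • (1 : End K V)) := h.ge hvW
    have h2 := this.2
    exact hne (by simpa [sub_eq_zero] using h2)

/-- Schur's bound for commuting endomorphisms over an algebraically closed field. -/
lemma schur_bound_end {K : Type*} [Field K] [IsAlgClosed K] (n : ℕ) :
    ∀ (V : Type _) [AddCommGroup V] [Module K V] [FiniteDimensional K V],
      finrank K V = n → ∀ (S : Submodule K (End K V)),
      (∀ f ∈ S, ∀ g ∈ S, f * g = g * f) → finrank K S ≤ n ^ 2 / 4 + 1 := by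
  induction n with
  | zero =>
    intro V _ _ _ hn S hS
    have := Submodule.finrank_le S
    rw [Module.finrank_linearMap, hn] at this
    omega
  | succ n ih =>
    intro V _ _ _ hn S hS
    rcases Nat.eq_zero_or_pos n with rfl | hpos
    · have := Submodule.finrank_le S
      rw [Module.finrank_linearMap, hn] at this
      omega
    have : Nontrivial V := Module.nontrivial_of_finrank_pos (R := K) (by omega)
    -- a common eigenvector of the transposes
    obtain ⟨h, -, h0, hh⟩ := exists_common_eigenvector (K := K) (V := Dual K V)
      (Set.image (fun f => Dual.transpose (R := K) f) (S : Set (End K V))) (by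
        rintro _ ⟨f, hf, rfl⟩ _ ⟨g, hg, rfl⟩
        ext φ x
        have := LinearMap.congr_fun (hS f hf g hg) x
        simp only [End.mul_apply] at this
        simp [Dual.transpose_apply, this]) ⊤ top_ne_bot (by simp)
    have hh' : ∀ f ∈ S, ∃ c : K, ∀ x, h (f x) = c * h x := by
      intro f hf
      obtain ⟨c, hc⟩ := hh _ ⟨f, hf, rfl⟩
      exact ⟨c, fun x => LinearMap.congr_fun hc x⟩
    set H := LinearMap.ker h with hH
    have hHinv : ∀ f ∈ S, ∀ x ∈ H, f x ∈ H := by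
      intro f hf x hx
      obtain ⟨c, hc⟩ := hh' f hf
      rw [hH, LinearMap.mem_ker] at *
      rw [hc, hx, mul_zero]
    have hHdim : finrank K H = n := by
      have := Dual.finrank_ker_add_one_of_ne_zero h0
      rw [← hH] at this
      omega
    have hHbot : H ≠ ⊥ := by
      intro hb
      rw [hb, finrank_bot] at hHdim
      omega
    obtain ⟨v, hvH, hv0, hv⟩ := exists_common_eigenvector (S : Set (End K V)) hS H hHbot hHinv
    have hhv : h v = 0 := hvH
    set p := K ∙ v with hp
    have hpinv : ∀ f ∈ S, p ≤ p.comap f := by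
      intro f hf x hx
      obtain ⟨a, rfl⟩ := Submodule.mem_span_singleton.1 hx
      obtain ⟨c, hc⟩ := hv f hf
      rw [Submodule.mem_comap, map_smul, hc]
      exact p.smul_mem _ (p.smul_mem _ (Submodule.mem_span_singleton_self v))
    have hQdim : finrank K (V ⧸ p) = n := by
      have h1 := Submodule.finrank_quotient_add_finrank p
      have h2 := finrank_span_singleton (K := K) hv0
      rw [← hp] at h2
      omega
    let Φ : S →ₗ[K] End K (V ⧸ p) :=
      { toFun := fun f => p.mapQ p f.1 (hpinv f.1 f.2)
        map_add' := fun f g => by ext x; simp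
        map_smul' := fun c f => by ext x; simp }
    let Ψ : S →ₗ[K] End K H :=
      { toFun := fun f => LinearMap.restrict f.1 (hHinv f.1 f.2)
        map_add' := fun f g => by ext x; simp
        map_smul' := fun c f => by ext x; simp }
    have hΦ : finrank K (LinearMap.range Φ) ≤ n ^ 2 / 4 + 1 := by
      refine ih _ hQdim _ ?_
      rintro _ ⟨f, rfl⟩ _ ⟨g, rfl⟩
      ext x
      have := LinearMap.congr_fun (hS f f.2 g g.2) x
      simp only [End.mul_apply] at this
      simp [Φ, this]
    have hΨ : finrank K (LinearMap.range Ψ) ≤ n ^ 2 / 4 + 1 := by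
      refine ih _ hHdim _ ?_
      rintro _ ⟨f, rfl⟩ _ ⟨g, rfl⟩
      ext x
      have := LinearMap.congr_fun (hS f f.2 g g.2) x
      simp only [End.mul_apply] at this
      simp [Ψ, this]
    have h1 := LinearMap.finrank_range_add_finrank_ker Φ
    have h2 := LinearMap.finrank_range_add_finrank_ker Ψ
    obtain ⟨g, hg⟩ := Projective.exists_dual_eq_one K hv0
    obtain ⟨e, he⟩ : ∃ e, h e = 1 := LinearMap.surjective h0 1
    have hkΦ : ∀ s ∈ LinearMap.ker Φ, ∀ x, s.1 x = g (s.1 x) • v := by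
      intro s hs x
      have h3 : Φ s (p.mkQ x) = 0 := by rw [LinearMap.mem_ker.1 hs]; rfl
      have h4 : s.1 x ∈ p := by simpa [Φ] using h3
      obtain ⟨a, ha⟩ := Submodule.mem_span_singleton.1 h4
      rw [← ha]; simp [hg]
    have hkΨ : ∀ t ∈ LinearMap.ker Ψ, ∀ x, h x = 0 → t.1 x = 0 := by
      intro t ht x hx
      have h3 : Ψ t ⟨x, hx⟩ = 0 := by rw [LinearMap.mem_ker.1 ht]; rfl
      exact congrArg Subtype.val h3
    let α : LinearMap.ker Ψ →ₗ[K] V :=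
      { toFun := fun t => t.1.1 e
        map_add' := fun f g => by simp
        map_smul' := fun c f => by simp }
    let β : LinearMap.ker Φ →ₗ[K] Dual K V :=
      { toFun := fun s => g ∘ₗ s.1.1
        map_add' := fun f g => by ext x; simp
        map_smul' := fun c f => by ext x; simp }
    have hα : Function.Injective α := by
      rw [injective_iff_map_eq_zero]
      intro t ht
      have ht' : t.1.1 e = 0 := ht
      apply Subtype.ext; apply Subtype.ext
      ext x
      have := hkΨ t.1 t.2 (x - h x • e) (by simp [he])
      simpa [ht'] using this
    have hβ : Function.Injective β := by
      rw [injective_iff_map_eq_zero]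
      intro s hs
      apply Subtype.ext; apply Subtype.ext
      ext x
      have h3 : g (s.1.1 x) = 0 := LinearMap.congr_fun hs x
      have := hkΦ s.1 s.2 x
      rw [h3, zero_smul] at this
      simpa using this
    have hle : LinearMap.range β ≤ (LinearMap.range α).dualAnnihilator := by
      rintro _ ⟨s, rfl⟩
      rw [Submodule.mem_dualAnnihilator]
      rintro _ ⟨t, rfl⟩
      change g (s.1.1 (t.1.1 e)) = 0
      have h3 : s.1.1 (t.1.1 e) = t.1.1 (s.1.1 e) :=
        LinearMap.congr_fun (hS _ s.1.2 _ t.1.2) e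
      rw [h3, hkΦ s.1 s.2 e, map_smul, hkΨ t.1 t.2 v hhv]
      simp
    have h3 := Submodule.finrank_mono hle
    have h4 := Subspace.finrank_add_finrank_dualAnnihilator_eq (LinearMap.range α)
    rw [LinearMap.finrank_range_of_inj hβ] at h3
    rw [LinearMap.finrank_range_of_inj hα] at h4
    have key : 2 * finrank K S ≤ 2 * (n ^ 2 / 4 + 1) + (n + 1) := by omega
    rcases Nat.even_or_odd' n with ⟨k, rfl | rfl⟩
    · have e1 : (2 * k) ^ 2 = 4 * (k ^ 2) := by ring
      have e2 : (2 * k + 1) ^ 2 = 4 * (k ^ 2) + 4 * k + 1 := by ring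
      omega
    · have e1 : (2 * k + 1) ^ 2 = 4 * (k ^ 2) + 4 * k + 1 := by ring
      have e2 : (2 * k + 1 + 1) ^ 2 = 4 * (k ^ 2) + 8 * k + 4 := by ring
      omega

/-- Schur's bound: a commuting linear subspace of `m × m` matrices
has dimension at most `⌊m²/4⌋ + 1`. -/
theorem schur_bound_commuting_matrices {F : Type*} [Field F] (m : ℕ)
    (S : Submodule F (Matrix (Fin m) (Fin m) F))
    (hcomm : ∀ X ∈ S, ∀ Y ∈ S, X * Y = Y * X) :
    Module.finrank F S ≤ m ^ 2 / 4 + 1 := by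
  let K := AlgebraicClosure F
  let b := Module.finBasis F S
  have hb : LinearIndependent F (fun i => (b i : Matrix (Fin m) (Fin m) F)) :=
    b.linearIndependent.map' S.subtype S.ker_subtype
  have hb2 : LinearIndependent F
      (fun i => (fun q : Fin m × Fin m => (b i : Matrix (Fin m) (Fin m) F) q.1 q.2)) :=
    hb.map' (LinearEquiv.curry F F (Fin m) (Fin m)).symm.toLinearMap (LinearEquiv.ker _)
  have hb3 := (linearIndependent_algebraMap_comp_iff (S := K)).2 hb2
  have hb4 := hb3.map' (LinearEquiv.curry K K (Fin m) (Fin m)).toLinearMap (LinearEquiv.ker _)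
  let w : Fin (finrank F S) → End K (Fin m → K) := fun i =>
    Matrix.toLin' ((b i : Matrix (Fin m) (Fin m) F).map (algebraMap F K))
  have hw : LinearIndependent K w :=
    hb4.map' (Matrix.toLin' (R := K) (m := Fin m) (n := Fin m)).toLinearMap (LinearEquiv.ker _)
  have hfr := finrank_span_eq_card hw
  rw [Fintype.card_fin] at hfr
  rw [← hfr]
  refine schur_bound_end m (Fin m → K) (by simp) _ ?_
  have hww : ∀ i j, w i * w j = w j * w i := by
    intro i j
    simp only [w]
    rw [Module.End.mul_eq_comp, Module.End.mul_eq_comp, ← Matrix.toLin'_mul, ← Matrix.toLin'_mul,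
      ← Matrix.map_mul, ← Matrix.map_mul, hcomm _ (b i).2 _ (b j).2]
  intro f hf g hg
  induction hf using Submodule.span_induction with
  | zero => simp
  | add x y _ _ hx hy => rw [add_mul, mul_add, hx, hy]
  | smul c x _ hx => rw [smul_mul_assoc, mul_smul_comm, hx]
  | mem x hx =>
    obtain ⟨i, rfl⟩ := hx
    induction hg using Submodule.span_induction with
    | zero => simp
    | add x y _ _ hx hy => rw [add_mul, mul_add, hx, hy]
    | smul c x _ hx => rw [smul_mul_assoc, mul_smul_comm, hx]
    | mem y hy =>
      obtain ⟨j, rfl⟩ := hy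
      exact hww i j
end
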